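/- For every β ≥ 0, the sequence (F_N(β))_{N≥1} of free energies of the Sherrington–Kirkpatrick model converges as N → ∞. -/

import Mathlib

open MeasureTheory ProbabilityTheory Real Filter
open scoped NNReal

/-- The law of the i.i.d. standard Gaussian coefficients `(W_{ij})_{1 ≤ i,j ≤ N}`. -/
noncomputable def gaussW (N : ℕ) : Measure ((Fin N × Fin N) → ℝ) :=
  Measure.pi fun _ => gaussianReal 0 1

/-- The Sherrington–Kirkpatrick Hamiltonian. -/
noncomputable def HSK (N : ℕ) (W : (Fin N × Fin N) → ℝ) (σ : Fin N → ℝ) : ℝ :=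
  (1 / Real.sqrt N) * ∑ i : Fin N, ∑ j : Fin N, W (i, j) * σ i * σ j

/-- The free energy `F_N(β) = N^{-1} E[log ∑_{σ ∈ {-1,1}^N} exp(β H_N(σ))]` of the SK model. -/
noncomputable def FSK (N : ℕ) (β : ℝ) : ℝ :=
  (1 / N) * ∫ W, Real.log (∑ σ : Fin N → ({-1, 1} : Finset ℝ),
    Real.exp (β * HSK N W fun i => (σ i : ℝ))) ∂(gaussW N)

/-- The sum of exponentials of a finite family. -/
noncomputable def sumExp {S : Type*} [Fintype S] (v : S → ℝ) : ℝ := ∑ σ, exp (v σ)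

/-- The Gibbs weights of a finite family. -/
noncomputable def softmax {S : Type*} [Fintype S] (v : S → ℝ) (σ : S) : ℝ :=
  exp (v σ) / sumExp v

section Softmax

variable {S : Type*} [Fintype S]

@[fun_prop]
lemma continuous_sumExp : Continuous (sumExp : (S → ℝ) → ℝ) := by
  unfold sumExp; fun_prop

lemma hasDerivAt_sumExp {e : ℝ → S → ℝ} {e' : S → ℝ} {x : ℝ}
    (he : ∀ σ, HasDerivAt (fun y => e y σ) (e' σ) x) :
    HasDerivAt (fun y => sumExp (e y)) (∑ σ, exp (e x σ) * e' σ) x :=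
  HasDerivAt.fun_sum fun σ _ => (he σ).exp

variable [Nonempty S]

lemma sumExp_pos (v : S → ℝ) : 0 < sumExp v :=
  Finset.sum_pos (fun _ _ => exp_pos _) Finset.univ_nonempty

lemma softmax_nonneg (v : S → ℝ) (σ : S) : 0 ≤ softmax v σ :=
  div_nonneg (exp_pos _).le (sumExp_pos v).le

lemma sum_softmax (v : S → ℝ) : ∑ σ, softmax v σ = 1 := by
  simp only [softmax, ← Finset.sum_div]
  exact div_self (sumExp_pos v).ne'

lemma softmax_le_one (v : S → ℝ) (σ : S) : softmax v σ ≤ 1 := by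
  rw [← sum_softmax v]
  exact Finset.single_le_sum (fun τ _ => softmax_nonneg v τ) (Finset.mem_univ σ)

lemma abs_sum_softmax_mul_le (v w : S → ℝ) : |∑ σ, softmax v σ * w σ| ≤ ∑ σ, |w σ| := by
  refine (Finset.abs_sum_le_sum_abs _ _).trans (Finset.sum_le_sum fun σ _ => ?_)
  rw [abs_mul, abs_of_nonneg (softmax_nonneg v σ)]
  exact mul_le_of_le_one_left (abs_nonneg _) (softmax_le_one v σ)

@[fun_prop]
lemma continuous_softmax (σ : S) : Continuous fun v : S → ℝ => softmax v σ :=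
  Continuous.div (by fun_prop) (by fun_prop) fun v => (sumExp_pos v).ne'

@[fun_prop]
lemma continuous_log_sumExp : Continuous fun v : S → ℝ => log (sumExp v) :=
  continuous_sumExp.log fun v => (sumExp_pos v).ne'

lemma hasDerivAt_log_sumExp {e : ℝ → S → ℝ} {e' : S → ℝ} {x : ℝ}
    (he : ∀ σ, HasDerivAt (fun y => e y σ) (e' σ) x) :
    HasDerivAt (fun y => log (sumExp (e y))) (∑ σ, softmax (e x) σ * e' σ) x := by
  convert (hasDerivAt_sumExp he).log (sumExp_pos _).ne' using 1
  rw [Finset.sum_div]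
  exact Finset.sum_congr rfl fun σ _ => by rw [softmax]; ring

lemma hasDerivAt_softmax {e : ℝ → S → ℝ} {e' : S → ℝ} {x : ℝ}
    (he : ∀ σ, HasDerivAt (fun y => e y σ) (e' σ) x) (σ : S) :
    HasDerivAt (fun y => softmax (e y) σ)
      (softmax (e x) σ * (e' σ - ∑ τ, softmax (e x) τ * e' τ)) x := by
  have h0 := (sumExp_pos (e x)).ne'
  refine ((he σ).exp.div (hasDerivAt_sumExp he) h0).congr_deriv ?_
  have : ∑ τ, softmax (e x) τ * e' τ = (∑ τ, exp (e x τ) * e' τ) / sumExp (e x) := by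
    rw [Finset.sum_div]
    exact Finset.sum_congr rfl fun τ _ => by rw [softmax]; ring
  rw [this, softmax]
  field_simp

lemma abs_log_sumExp_le (v : S → ℝ) :
    |log (sumExp v)| ≤ log (Fintype.card S) + ∑ σ, |v σ| := by
  have hle : ∀ σ, |v σ| ≤ ∑ τ, |v τ| := fun σ =>
    Finset.single_le_sum (f := fun τ => |v τ|) (fun τ _ => abs_nonneg _) (Finset.mem_univ σ)
  have hcard : (0 : ℝ) < Fintype.card S := by exact_mod_cast Fintype.card_pos
  have hlog : 0 ≤ log (Fintype.card S) :=
    log_nonneg (by exact_mod_cast Nat.one_le_iff_ne_zero.2 Fintype.card_ne_zero)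
  rw [abs_le]
  constructor
  · obtain ⟨σ⟩ := ‹Nonempty S›
    have h1 : exp (v σ) ≤ sumExp v :=
      Finset.single_le_sum (f := fun τ => exp (v τ)) (fun τ _ => (exp_pos _).le)
        (Finset.mem_univ σ)
    have h2 := (le_log_iff_exp_le (sumExp_pos v)).2 h1
    linarith [hle σ, neg_abs_le (v σ)]
  · rw [log_le_iff_le_exp (sumExp_pos v), exp_add, exp_log hcard, sumExp, ← nsmul_eq_mul]
    exact Finset.sum_le_card_nsmul _ _ _ fun σ _ =>
      exp_le_exp.2 ((le_abs_self _).trans (hle σ))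

end Softmax

section Stein

lemma integrable_gaussianReal_iff {f : ℝ → ℝ} :
    Integrable f (gaussianReal 0 1) ↔ Integrable fun x => gaussianPDFReal 0 1 x * f x := by
  rw [gaussianReal_of_var_ne_zero _ one_ne_zero,
    integrable_withDensity_iff_integrable_smul' (measurable_gaussianPDF _ _)
      (ae_of_all _ fun _ => gaussianPDF_lt_top)]
  simp

lemma hasDerivAt_gaussianPDFReal (x : ℝ) :
    HasDerivAt (gaussianPDFReal 0 1) (-(gaussianPDFReal 0 1 x * x)) x := by
  have h : HasDerivAt (fun y : ℝ => -(y - 0) ^ 2 / (2 * ((1 : ℝ≥0) : ℝ))) (-x) x := by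
    refine ((((hasDerivAt_id x).sub_const 0).pow 2).neg.div_const
      (2 * ((1 : ℝ≥0) : ℝ))).congr_deriv ?_
    simp
    ring
  rw [gaussianPDFReal_def]
  refine (h.exp.const_mul _).congr_deriv ?_
  ring

/-- Stein's lemma for the standard Gaussian measure. -/
lemma integral_mul_gaussianReal {h h' : ℝ → ℝ} {C : ℝ} (hd : ∀ x, HasDerivAt h (h' x) x)
    (hc : Continuous h') (hb : ∀ x, |h x| ≤ C) (hb' : ∀ x, |h' x| ≤ C) :
    ∫ x, x * h x ∂gaussianReal 0 1 = ∫ x, h' x ∂gaussianReal 0 1 := by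
  have hcont : Continuous h := continuous_iff_continuousAt.2 fun x => (hd x).continuousAt
  have hid : Integrable (fun x : ℝ => x) (gaussianReal 0 1) :=
    (memLp_id_gaussianReal' 1 (by simp)).integrable le_rfl
  have i1 : Integrable (fun x => x * h x) (gaussianReal 0 1) :=
    hid.mul_bdd (c := C) hcont.aestronglyMeasurable (ae_of_all _ hb)
  have i2 : Integrable h' (gaussianReal 0 1) :=
    Integrable.of_bound hc.aestronglyMeasurable C (ae_of_all _ hb')
  have i3 : Integrable h (gaussianReal 0 1) :=
    Integrable.of_bound hcont.aestronglyMeasurable C (ae_of_all _ hb)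
  rw [integrable_gaussianReal_iff] at i1 i2 i3
  have key := integral_mul_deriv_eq_deriv_mul_of_integrable
    (u := h) (v := gaussianPDFReal 0 1) (fun x _ => hd x)
    (fun x _ => hasDerivAt_gaussianPDFReal x)
    (by convert i1.neg using 1; ext x; simp; ring) (by convert i2 using 1; ext x; simp; ring)
    (by convert i3 using 1; ext x; simp; ring)
  rw [integral_gaussianReal_eq_integral_smul one_ne_zero,
    integral_gaussianReal_eq_integral_smul one_ne_zero]
  calc _ = -∫ x, h x * -(gaussianPDFReal 0 1 x * x) := by
        rw [← integral_neg]; congr with x; simp; ring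
    _ = _ := by rw [key, neg_neg]; congr with x; simp; ring

end Stein

section StdPi

variable {ι : Type*} [Fintype ι]

/-- The law of a finite family of independent standard Gaussian variables. -/
noncomputable def gaussPi (ι : Type*) [Fintype ι] : Measure (ι → ℝ) :=
  Measure.pi fun _ => gaussianReal 0 1

instance : IsProbabilityMeasure (gaussPi ι) := by unfold gaussPi; infer_instance

lemma measurePreserving_comp_gaussPi {κ : Type*} [Fintype κ] {f : κ → ι}
    (hf : Function.Injective f) :
    MeasurePreserving (fun g : ι → ℝ => g ∘ f) (gaussPi ι) (gaussPi κ) := by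
  refine ⟨by fun_prop, ?_⟩
  have h := iIndepFun_pi (μ := fun _ : ι => gaussianReal 0 1) (X := fun _ x => x)
    (fun _ => aemeasurable_id)
  have h2 := (iIndepFun_iff_map_fun_eq_pi_map (fun i => (measurable_pi_apply _).aemeasurable)).1 (h.precomp hf)
  refine h2.trans ?_
  rw [gaussPi]
  congr with i : 1
  exact (measurePreserving_eval (fun _ : ι => gaussianReal 0 1) (f i)).map_eq

lemma measurePreserving_update_gaussPi [DecidableEq ι] (i : ι) :
    MeasurePreserving (fun z : (ι → ℝ) × ℝ => Function.update z.1 i z.2)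
      ((gaussPi ι).prod (gaussianReal 0 1)) (gaussPi ι) := by
  have hm : Measurable fun z : (ι → ℝ) × ℝ => Function.update z.1 i z.2 := by
    refine measurable_pi_lambda _ fun j => ?_
    by_cases hj : j = i
    · subst hj; simpa using measurable_snd
    · simp only [Function.update_of_ne hj]; fun_prop
  refine ⟨hm, ?_⟩
  symm
  refine Measure.pi_eq fun s hs => ?_
  rw [Measure.map_apply hm (MeasurableSet.univ_pi hs)]
  have : (fun z : (ι → ℝ) × ℝ => Function.update z.1 i z.2) ⁻¹' Set.univ.pi s =
      (Set.univ.pi (Function.update s i Set.univ)) ×ˢ s i := by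
    ext z
    simp only [Set.mem_preimage, Set.mem_pi, Set.mem_univ, true_implies, Set.mem_prod]
    constructor
    · refine fun h => ⟨fun j => ?_, by simpa using h i⟩
      by_cases hj : j = i
      · subst hj; simp
      · simpa [Function.update_of_ne hj] using h j
    · rintro ⟨h1, h2⟩ j
      by_cases hj : j = i
      · subst hj; simpa using h2
      · simpa [Function.update_of_ne hj] using h1 j
  rw [this, Measure.prod_prod, gaussPi, Measure.pi_pi, ← Finset.mul_prod_erase _ _ (Finset.mem_univ i),
    ← Finset.mul_prod_erase _ _ (Finset.mem_univ i), mul_comm]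
  simp only [Function.update_self, measure_univ, one_mul]
  congr 1
  refine Finset.prod_congr rfl fun j hj => ?_
  rw [Function.update_of_ne (Finset.ne_of_mem_erase hj)]

lemma integrable_eval_gaussPi (i : ι) : Integrable (fun g : ι → ℝ => g i) (gaussPi ι) :=
  integrable_comp_eval (μ := fun _ : ι => gaussianReal 0 1) (f := fun x => x)
    ((memLp_id_gaussianReal' 1 (by simp)).integrable le_rfl)

lemma integrable_dotProduct_gaussPi (l : ι → ℝ) :
    Integrable (fun g : ι → ℝ => l ⬝ᵥ g) (gaussPi ι) :=
  integrable_finsetSum _ fun i _ => (integrable_eval_gaussPi i).const_mul (l i)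

/-- Gaussian integration by parts in one coordinate. -/
lemma integral_eval_mul_gaussPi [DecidableEq ι] (i : ι) {f f' : (ι → ℝ) → ℝ} {C : ℝ}
    (hd : ∀ g x, HasDerivAt (fun y => f (Function.update g i y)) (f' (Function.update g i x)) x)
    (hf : Continuous f) (hf' : Continuous f') (hb : ∀ g, |f g| ≤ C) (hb' : ∀ g, |f' g| ≤ C) :
    ∫ g, g i * f g ∂gaussPi ι = ∫ g, f' g ∂gaussPi ι := by
  have mp := measurePreserving_update_gaussPi i
  have i1 : Integrable (fun g => g i * f g) (gaussPi ι) :=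
    (integrable_eval_gaussPi i).mul_bdd (c := C) hf.aestronglyMeasurable (ae_of_all _ hb)
  have i2 : Integrable f' (gaussPi ι) :=
    Integrable.of_bound hf'.aestronglyMeasurable C (ae_of_all _ hb')
  have j1 := mp.integrable_comp_of_integrable i1
  have j2 := mp.integrable_comp_of_integrable i2
  rw [← mp.map_eq, integral_map mp.measurable.aemeasurable (by rw [mp.map_eq]; exact i1.1),
    integral_map mp.measurable.aemeasurable (by rw [mp.map_eq]; exact i2.1)]
  refine (integral_prod _ j1).trans (Eq.trans ?_ (integral_prod _ j2).symm)
  congr with g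
  simp only [Function.comp_apply, Function.update_self]
  exact integral_mul_gaussianReal (hd g)
    (hf'.comp (by fun_prop)) (fun x => hb _) (fun x => hb' _)

lemma hasDerivAt_dotProduct_update [DecidableEq ι] (l g : ι → ℝ) (i : ι) (x : ℝ) :
    HasDerivAt (fun y => l ⬝ᵥ Function.update g i y) (l i) x := by
  have h := HasDerivAt.fun_sum (u := Finset.univ) fun j _ =>
    ((hasDerivAt_pi.1 (hasDerivAt_update g i x)) j).const_mul (l j)
  exact h.congr_deriv (by simp [Pi.single_apply])

lemma integral_comp_gaussPi {κ : Type*} [Fintype κ] {f : κ → ι} (hf : Function.Injective f)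
    {F : (κ → ℝ) → ℝ} (hF : Continuous F) :
    ∫ g, F (g ∘ f) ∂gaussPi ι = ∫ g, F g ∂gaussPi κ := by
  have mp := measurePreserving_comp_gaussPi hf
  rw [← mp.map_eq, integral_map mp.measurable.aemeasurable hF.aestronglyMeasurable]

lemma integrable_exp_dotProduct_gaussPi (l : ι → ℝ) :
    Integrable (fun g : ι → ℝ => exp (l ⬝ᵥ g)) (gaussPi ι) := by
  simp only [dotProduct, exp_sum]
  exact Integrable.fintype_prod (f := fun i x => exp (l i * x))
    fun i => integrable_exp_mul_gaussianReal (l i)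

lemma integral_exp_dotProduct_gaussPi (l : ι → ℝ) :
    ∫ g, exp (l ⬝ᵥ g) ∂gaussPi ι = exp (l ⬝ᵥ l / 2) := by
  simp only [dotProduct, exp_sum, Finset.sum_div]
  refine (integral_fintype_prod_eq_prod (𝕜 := ℝ) (fun i x => exp (l i * x))).trans ?_
  refine Finset.prod_congr rfl fun i _ => ?_
  have h := congrFun (mgf_id_gaussianReal (μ := 0) (v := 1)) (l i)
  simp only [mgf, id] at h
  rw [h]
  congr 1
  simp
  ring

end StdPi

section Comparison

lemma continuous_dotProduct_family {S ι : Type*} [Fintype ι] (l : S → ι → ℝ) :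
    Continuous fun (g : ι → ℝ) (σ : S) => l σ ⬝ᵥ g := by
  unfold dotProduct; fun_prop

variable {S ι : Type*} [Fintype S] [Nonempty S] [Fintype ι]

lemma integrable_log_sumExp_dotProduct (l : S → ι → ℝ) :
    Integrable (fun g : ι → ℝ => log (sumExp fun σ => l σ ⬝ᵥ g)) (gaussPi ι) := by
  refine Integrable.mono' (g := fun g => log (Fintype.card S) + ∑ σ, |l σ ⬝ᵥ g|) ?_ ?_
    (ae_of_all _ fun g => abs_log_sumExp_le _)
  · exact (integrable_const _).add
      (integrable_finsetSum _ fun σ _ => (integrable_dotProduct_gaussPi (l σ)).abs)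
  · exact (continuous_log_sumExp.comp (continuous_dotProduct_family l)).aestronglyMeasurable

/-- Gaussian integration by parts for Gibbs averages. -/
lemma integral_softmax_mul_dotProduct (l c : S → ι → ℝ) :
    ∫ g, ∑ σ, softmax (fun τ => l τ ⬝ᵥ g) σ * (c σ ⬝ᵥ g) ∂gaussPi ι =
      ∫ g, ∑ σ, softmax (fun τ => l τ ⬝ᵥ g) σ *
        (c σ ⬝ᵥ l σ - ∑ τ, softmax (fun τ => l τ ⬝ᵥ g) τ * (c σ ⬝ᵥ l τ)) ∂gaussPi ι := by
  classical
  have hcl := continuous_dotProduct_family l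
  have hcs : ∀ σ, Continuous fun g : ι → ℝ => softmax (fun τ => l τ ⬝ᵥ g) σ :=
    fun σ => (continuous_softmax σ).comp hcl
  have hcd : ∀ σ i, Continuous fun g : ι → ℝ => softmax (fun τ => l τ ⬝ᵥ g) σ *
      (l σ i - ∑ τ, softmax (fun τ => l τ ⬝ᵥ g) τ * l τ i) := fun σ i =>
    (hcs σ).mul (continuous_const.sub
      (continuous_finsetSum _ fun τ _ => (hcs τ).mul continuous_const))
  have hb : ∀ σ i (g : ι → ℝ), |softmax (fun τ => l τ ⬝ᵥ g) σ *
      (l σ i - ∑ τ, softmax (fun τ => l τ ⬝ᵥ g) τ * l τ i)| ≤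
        1 + (|l σ i| + ∑ τ, |l τ i|) := fun σ i g => by
    have h1 := abs_sum_softmax_mul_le (fun τ => l τ ⬝ᵥ g) fun τ => l τ i
    rw [abs_mul, abs_of_nonneg (softmax_nonneg _ σ)]
    refine (mul_le_of_le_one_left (abs_nonneg _) (softmax_le_one _ σ)).trans ?_
    linarith [abs_sub (l σ i) (∑ τ, softmax (fun τ => l τ ⬝ᵥ g) τ * l τ i)]
  have hs1 : ∀ σ (g : ι → ℝ), |softmax (fun τ => l τ ⬝ᵥ g) σ| ≤ 1 := fun σ g => by
    rw [abs_of_nonneg (softmax_nonneg _ σ)]; exact softmax_le_one _ σ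
  have hibp : ∀ σ i, ∫ g, g i * softmax (fun τ => l τ ⬝ᵥ g) σ ∂gaussPi ι =
      ∫ g, softmax (fun τ => l τ ⬝ᵥ g) σ *
        (l σ i - ∑ τ, softmax (fun τ => l τ ⬝ᵥ g) τ * l τ i) ∂gaussPi ι := fun σ i =>
    integral_eval_mul_gaussPi i
      (fun g x => hasDerivAt_softmax (fun τ => hasDerivAt_dotProduct_update (l τ) g i x) σ)
      (hcs σ) (hcd σ i)
      (fun g => (hs1 σ g).trans (le_add_of_nonneg_right (by positivity))) (hb σ i)
  have e1 : ∀ g : ι → ℝ, ∑ σ, softmax (fun τ => l τ ⬝ᵥ g) σ * (c σ ⬝ᵥ g) =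
      ∑ σ, ∑ i, c σ i * (g i * softmax (fun τ => l τ ⬝ᵥ g) σ) := fun g => by
    refine Finset.sum_congr rfl fun σ _ => ?_
    rw [dotProduct, Finset.mul_sum]
    exact Finset.sum_congr rfl fun i _ => by ring
  have e2 : ∀ g : ι → ℝ, ∑ σ, softmax (fun τ => l τ ⬝ᵥ g) σ *
        (c σ ⬝ᵥ l σ - ∑ τ, softmax (fun τ => l τ ⬝ᵥ g) τ * (c σ ⬝ᵥ l τ)) =
      ∑ σ, ∑ i, c σ i * (softmax (fun τ => l τ ⬝ᵥ g) σ *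
        (l σ i - ∑ τ, softmax (fun τ => l τ ⬝ᵥ g) τ * l τ i)) := fun g => by
    refine Finset.sum_congr rfl fun σ _ => ?_
    have : ∑ τ, softmax (fun τ => l τ ⬝ᵥ g) τ * (c σ ⬝ᵥ l τ) =
        ∑ i, c σ i * ∑ τ, softmax (fun τ => l τ ⬝ᵥ g) τ * l τ i := by
      simp only [dotProduct, Finset.mul_sum]
      rw [Finset.sum_comm]
      exact Finset.sum_congr rfl fun i _ => Finset.sum_congr rfl fun τ _ => by ring
    rw [this, dotProduct, ← Finset.sum_sub_distrib, Finset.mul_sum]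
    exact Finset.sum_congr rfl fun i _ => by ring
  have i1 : ∀ σ i, Integrable (fun g => c σ i * (g i * softmax (fun τ => l τ ⬝ᵥ g) σ))
      (gaussPi ι) := fun σ i =>
    ((integrable_eval_gaussPi i).mul_bdd (c := 1) (hcs σ).aestronglyMeasurable
      (ae_of_all _ (hs1 σ))).const_mul _
  have i2 : ∀ σ i, Integrable (fun g => c σ i * (softmax (fun τ => l τ ⬝ᵥ g) σ *
        (l σ i - ∑ τ, softmax (fun τ => l τ ⬝ᵥ g) τ * l τ i))) (gaussPi ι) := fun σ i =>
    (Integrable.of_bound (hcd σ i).aestronglyMeasurable _ (ae_of_all _ (hb σ i))).const_mul _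
  simp only [e1, e2]
  rw [integral_finsetSum _ fun σ _ => integrable_finsetSum _ fun i _ => i1 σ i,
    integral_finsetSum _ fun σ _ => integrable_finsetSum _ fun i _ => i2 σ i]
  refine Finset.sum_congr rfl fun σ _ => ?_
  rw [integral_finsetSum _ fun i _ => i1 σ i, integral_finsetSum _ fun i _ => i2 σ i]
  refine Finset.sum_congr rfl fun i _ => ?_
  rw [integral_const_mul, integral_const_mul, hibp]

lemma integral_log_sumExp_le {l : S → ι → ℝ} {K : ℝ} (hK : ∀ σ, l σ ⬝ᵥ l σ = K) :
    ∫ g, log (sumExp fun σ => l σ ⬝ᵥ g) ∂gaussPi ι ≤ log (Fintype.card S) + K / 2 := by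
  have hcard : (0 : ℝ) < Fintype.card S := by exact_mod_cast Fintype.card_pos
  set M : ℝ := Fintype.card S * exp (K / 2) with hM
  have hMpos : 0 < M := by positivity
  have hint : Integrable (fun g => sumExp fun σ => l σ ⬝ᵥ g) (gaussPi ι) :=
    integrable_finsetSum _ fun σ _ => integrable_exp_dotProduct_gaussPi (l σ)
  have hval : ∫ g, sumExp (fun σ => l σ ⬝ᵥ g) ∂gaussPi ι = M := by
    unfold sumExp
    rw [integral_finsetSum _ fun σ _ => integrable_exp_dotProduct_gaussPi (l σ)]
    simp [integral_exp_dotProduct_gaussPi, hK, hM]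
  have hle : ∀ g : ι → ℝ, log (sumExp fun σ => l σ ⬝ᵥ g) ≤
      (sumExp fun σ => l σ ⬝ᵥ g) / M + (log M - 1) := fun g => by
    have h := log_le_sub_one_of_pos (div_pos (sumExp_pos fun σ => l σ ⬝ᵥ g) hMpos)
    rw [log_div (sumExp_pos _).ne' hMpos.ne'] at h
    linarith
  refine (integral_mono (integrable_log_sumExp_dotProduct l)
    ((hint.div_const M).add (integrable_const _)) hle).trans_eq ?_
  refine (integral_add (hint.div_const M) (integrable_const _)).trans ?_
  rw [integral_div, hval,
    div_self hMpos.ne', hM, log_mul hcard.ne' (exp_pos _).ne', log_exp]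
  simp

/-- Comparison of the expected log-partition functions of two Gaussian processes with equal
variances and ordered covariances. -/
theorem integral_log_sumExp_mono {κ : Type*} [Fintype κ] (A : S → ι → ℝ) (B : S → κ → ℝ)
    (hdiag : ∀ σ, A σ ⬝ᵥ A σ = B σ ⬝ᵥ B σ) (hle : ∀ σ τ, A σ ⬝ᵥ A τ ≤ B σ ⬝ᵥ B τ) :
    ∫ g, log (sumExp fun σ => B σ ⬝ᵥ g) ∂gaussPi κ ≤
      ∫ g, log (sumExp fun σ => A σ ⬝ᵥ g) ∂gaussPi ι := by
  let L : ℝ → S → ι ⊕ κ → ℝ := fun θ σ => Sum.elim (cos θ • A σ) (sin θ • B σ)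
  let L' : ℝ → S → ι ⊕ κ → ℝ := fun θ σ => Sum.elim (-sin θ • A σ) (cos θ • B σ)
  let Φ : ℝ → ℝ := fun θ => ∫ g, log (sumExp fun σ => L θ σ ⬝ᵥ g) ∂gaussPi (ι ⊕ κ)
  have hL : ∀ (g : ι ⊕ κ → ℝ) θ σ, HasDerivAt (fun θ => L θ σ ⬝ᵥ g) (L' θ σ ⬝ᵥ g) θ := by
    intro g θ σ
    refine HasDerivAt.fun_sum fun i _ => HasDerivAt.mul_const ?_ (g i)
    rcases i with i | i
    · exact (hasDerivAt_cos θ).mul_const _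
    · exact (hasDerivAt_sin θ).mul_const _
  have hbound : ∀ (g : ι ⊕ κ → ℝ) θ,
      ‖∑ σ, softmax (fun τ => L θ τ ⬝ᵥ g) σ * (L' θ σ ⬝ᵥ g)‖ ≤
        ∑ σ, ∑ i, |Sum.elim (A σ) (B σ) i| * |g i| := by
    intro g θ
    refine (abs_sum_softmax_mul_le _ _).trans (Finset.sum_le_sum fun σ _ => ?_)
    refine (Finset.abs_sum_le_sum_abs _ _).trans (Finset.sum_le_sum fun i _ => ?_)
    rw [abs_mul]
    refine mul_le_mul_of_nonneg_right ?_ (abs_nonneg _)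
    rcases i with i | i
    · simpa [L', abs_mul] using mul_le_of_le_one_left (abs_nonneg (A σ i)) (abs_sin_le_one θ)
    · simpa [L', abs_mul] using mul_le_of_le_one_left (abs_nonneg (B σ i)) (abs_cos_le_one θ)
  have hderiv : ∀ θ, HasDerivAt Φ
      (∫ g, ∑ σ, softmax (fun τ => L θ τ ⬝ᵥ g) σ * (L' θ σ ⬝ᵥ g) ∂gaussPi (ι ⊕ κ)) θ := by
    intro θ
    refine (hasDerivAt_integral_of_dominated_loc_of_deriv_le (s := Set.univ)
      (F := fun θ g => log (sumExp fun σ => L θ σ ⬝ᵥ g))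
      (F' := fun θ g => ∑ σ, softmax (fun τ => L θ τ ⬝ᵥ g) σ * (L' θ σ ⬝ᵥ g))
      (bound := fun g => ∑ σ, ∑ i, |Sum.elim (A σ) (B σ) i| * |g i|) univ_mem
      (Eventually.of_forall fun θ => (integrable_log_sumExp_dotProduct (L θ)).1)
      (integrable_log_sumExp_dotProduct (L θ)) ?_
      (ae_of_all _ fun g θ _ => hbound g θ) ?_
      (ae_of_all _ fun g θ _ => hasDerivAt_log_sumExp fun σ => hL g θ σ)).2
    · refine Continuous.aestronglyMeasurable (continuous_finsetSum _ fun σ _ => ?_)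
      exact ((continuous_softmax σ).comp (continuous_dotProduct_family (L θ))).mul
        ((continuous_apply σ).comp (continuous_dotProduct_family (L' θ)))
    · exact integrable_finsetSum _ fun σ _ => integrable_finsetSum _ fun i _ =>
        (integrable_eval_gaussPi i).abs.const_mul _
  have hcov : ∀ θ σ τ, L' θ σ ⬝ᵥ L θ τ = sin θ * cos θ * (B σ ⬝ᵥ B τ - A σ ⬝ᵥ A τ) := by
    intro θ σ τ
    simp only [L, L', sumElim_dotProduct_sumElim, smul_dotProduct, dotProduct_smul,
      smul_eq_mul]
    ring
  have hanti : AntitoneOn Φ (Set.Icc 0 (π / 2)) := by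
    refine antitoneOn_of_deriv_nonpos (convex_Icc _ _)
      (fun θ _ => (hderiv θ).continuousAt.continuousWithinAt)
      (fun θ _ => (hderiv θ).differentiableAt.differentiableWithinAt) fun θ hθ => ?_
    rw [interior_Icc] at hθ
    have hsin : 0 ≤ sin θ := (sin_pos_of_mem_Ioo ⟨hθ.1, by linarith [hθ.2, pi_pos]⟩).le
    have hcos : 0 ≤ cos θ := (cos_pos_of_mem_Ioo ⟨by linarith [hθ.1, pi_pos], hθ.2⟩).le
    rw [(hderiv θ).deriv, integral_softmax_mul_dotProduct]
    refine integral_nonpos fun g => Finset.sum_nonpos fun σ _ =>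
      mul_nonpos_of_nonneg_of_nonpos (softmax_nonneg _ _) ?_
    rw [hcov, hdiag, sub_self, mul_zero, zero_sub, neg_nonpos]
    refine Finset.sum_nonneg fun τ _ => mul_nonneg (softmax_nonneg _ _) ?_
    rw [hcov]
    exact mul_nonneg (mul_nonneg hsin hcos) (sub_nonneg.2 (hle σ τ))
  have h0 : Φ 0 = ∫ g, log (sumExp fun σ => A σ ⬝ᵥ g) ∂gaussPi ι := by
    refine Eq.trans ?_ (integral_comp_gaussPi (Sum.inl_injective (β := κ))
      (continuous_log_sumExp.comp (continuous_dotProduct_family A)))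
    simp [Φ, L, dotProduct, Fintype.sum_sum_type]
  have h1 : Φ (π / 2) = ∫ g, log (sumExp fun σ => B σ ⬝ᵥ g) ∂gaussPi κ := by
    refine Eq.trans ?_ (integral_comp_gaussPi (Sum.inr_injective (α := ι))
      (continuous_log_sumExp.comp (continuous_dotProduct_family B)))
    simp [Φ, L, dotProduct, Fintype.sum_sum_type]
  rw [← h0, ← h1]
  exact hanti ⟨le_rfl, by positivity⟩ ⟨by positivity, le_rfl⟩ (by positivity)

end Comparison

section SK

/-- The coefficients of the linear form `W ↦ β * HSK N W σ`. -/
noncomputable def skCoeff (N : ℕ) (β : ℝ) (σ : Fin N → ℝ) (p : Fin N × Fin N) : ℝ :=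
  β / √N * (σ p.1 * σ p.2)

lemma skCoeff_dotProduct (N : ℕ) (β : ℝ) (σ : Fin N → ℝ) (W : Fin N × Fin N → ℝ) :
    skCoeff N β σ ⬝ᵥ W = β * HSK N W σ := by
  simp only [dotProduct, skCoeff, HSK, Fintype.sum_prod_type, Finset.mul_sum]
  exact Finset.sum_congr rfl fun i _ => Finset.sum_congr rfl fun j _ => by ring

lemma skCoeff_dotProduct_skCoeff (N : ℕ) (β : ℝ) (σ τ : Fin N → ℝ) :
    skCoeff N β σ ⬝ᵥ skCoeff N β τ = β ^ 2 * ((σ ⬝ᵥ τ) ^ 2 / N) := by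
  have h : (β / √N) ^ 2 = β ^ 2 / N := by rw [div_pow, sq_sqrt (Nat.cast_nonneg N)]
  calc _ = (β / √N) ^ 2 * (σ ⬝ᵥ τ) ^ 2 := by
        rw [sq (σ ⬝ᵥ τ)]
        simp only [dotProduct, skCoeff, Fintype.sum_prod_type]
        rw [Finset.sum_mul_sum]
        simp only [Finset.mul_sum]
        exact Finset.sum_congr rfl fun i _ => Finset.sum_congr rfl fun j _ => by ring
    _ = _ := by rw [h]; ring

instance : Nonempty ({-1, 1} : Finset ℝ) := ⟨⟨1, by simp⟩⟩

lemma spin_mul_self (s : ({-1, 1} : Finset ℝ)) : (s : ℝ) * s = 1 := by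
  have h := s.2
  simp only [Finset.mem_insert, Finset.mem_singleton] at h
  rcases h with h | h <;> rw [h] <;> norm_num

lemma spin_dotProduct_self {N : ℕ} (σ : Fin N → ({-1, 1} : Finset ℝ)) :
    (fun i => (σ i : ℝ)) ⬝ᵥ (fun i => (σ i : ℝ)) = N := by
  simp [dotProduct, spin_mul_self]

/-- The expected log-partition function of the SK model. -/
noncomputable def skLogPartition (N : ℕ) (β : ℝ) : ℝ :=
  ∫ W, log (sumExp fun σ : Fin N → ({-1, 1} : Finset ℝ) =>
    skCoeff N β (fun i => (σ i : ℝ)) ⬝ᵥ W) ∂gaussPi (Fin N × Fin N)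

lemma FSK_eq (N : ℕ) (β : ℝ) : FSK N β = skLogPartition N β / N := by
  simp only [FSK, skLogPartition, skCoeff_dotProduct, sumExp, gaussW, gaussPi]
  ring

lemma skLogPartition_le (N : ℕ) (β : ℝ) :
    skLogPartition N β ≤
      N * (log (Fintype.card ({-1, 1} : Finset ℝ)) + β ^ 2 / 2) := by
  refine (integral_log_sumExp_le (K := β ^ 2 * N) fun σ => ?_).trans_eq ?_
  · rw [skCoeff_dotProduct_skCoeff, spin_dotProduct_self]
    by_cases hN : (N : ℝ) = 0
    · simp [hN]
    · field_simp
  · rw [Fintype.card_fun, Nat.cast_pow, log_pow, Fintype.card_fin]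
    ring

lemma sq_add_div_le (m n : ℕ) {x y : ℝ} (hx : m = 0 → x = 0) (hy : n = 0 → y = 0) :
    (x + y) ^ 2 / ((m + n : ℕ) : ℝ) ≤ x ^ 2 / m + y ^ 2 / n := by
  rcases Nat.eq_zero_or_pos m with rfl | hm
  · simp [hx rfl]
  rcases Nat.eq_zero_or_pos n with rfl | hn
  · simp [hy rfl]
  have hm' : (0 : ℝ) < m := by exact_mod_cast hm
  have hn' : (0 : ℝ) < n := by exact_mod_cast hn
  push_cast
  rw [div_add_div _ _ hm'.ne' hn'.ne', div_le_div_iff₀ (by positivity) (by positivity)]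
  nlinarith [sq_nonneg (x * n - y * m)]

lemma append_dotProduct_append {m n : ℕ} (a c : Fin m → ℝ) (b d : Fin n → ℝ) :
    Fin.append a b ⬝ᵥ Fin.append c d = a ⬝ᵥ c + b ⬝ᵥ d := by
  simp [dotProduct, Fin.sum_univ_add]

lemma sumExp_add {S T : Type*} [Fintype S] [Fintype T] (v : S → ℝ) (w : T → ℝ) :
    (sumExp fun p : S × T => v p.1 + w p.2) = sumExp v * sumExp w := by
  simp only [sumExp, exp_add, Fintype.sum_prod_type, Finset.sum_mul_sum]

/-- Guerra–Toninelli superadditivity. -/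
theorem skLogPartition_add_le (m n : ℕ) (β : ℝ) :
    skLogPartition m β + skLogPartition n β ≤ skLogPartition (m + n) β := by
  let T := ({-1, 1} : Finset ℝ)
  let a : (Fin m → T) → Fin m × Fin m → ℝ := fun σ => skCoeff m β fun i => (σ i : ℝ)
  let b : (Fin n → T) → Fin n × Fin n → ℝ := fun σ => skCoeff n β fun i => (σ i : ℝ)
  let A : (Fin m → T) × (Fin n → T) → Fin (m + n) × Fin (m + n) → ℝ := fun p =>
    skCoeff (m + n) β (Fin.append (fun i => (p.1 i : ℝ)) fun i => (p.2 i : ℝ))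
  let B : (Fin m → T) × (Fin n → T) → (Fin m × Fin m) ⊕ (Fin n × Fin n) → ℝ := fun p =>
    Sum.elim (a p.1) (b p.2)
  have hA : ∫ W, log (sumExp fun p => A p ⬝ᵥ W) ∂gaussPi (Fin (m + n) × Fin (m + n)) =
      skLogPartition (m + n) β := by
    unfold skLogPartition
    congr with W
    congr 1
    refine Fintype.sum_equiv (Fin.appendEquiv m n) _ _ fun p => ?_
    have hp : Fin.append (fun i => (p.1 i : ℝ)) (fun i => (p.2 i : ℝ)) =
        fun i => ((Fin.appendEquiv m n p i : T) : ℝ) := by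
      ext i
      refine Fin.addCases (fun i => ?_) (fun i => ?_) i <;> simp [Fin.appendEquiv]
    simp only [A, hp]
  have hB : ∫ W, log (sumExp fun p => B p ⬝ᵥ W) ∂gaussPi ((Fin m × Fin m) ⊕ (Fin n × Fin n)) =
      skLogPartition m β + skLogPartition n β := by
    have ha := continuous_log_sumExp.comp (continuous_dotProduct_family a)
    have hb := continuous_log_sumExp.comp (continuous_dotProduct_family b)
    have hsplit : ∀ W, log (sumExp fun p => B p ⬝ᵥ W) =
        log (sumExp fun σ => a σ ⬝ᵥ (W ∘ Sum.inl)) +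
          log (sumExp fun σ => b σ ⬝ᵥ (W ∘ Sum.inr)) := fun W => by
      rw [← log_mul (sumExp_pos _).ne' (sumExp_pos _).ne', ← sumExp_add]
      simp [B, dotProduct, Fintype.sum_sum_type]
    simp only [hsplit]
    refine (integral_add
      ((measurePreserving_comp_gaussPi Sum.inl_injective).integrable_comp_of_integrable
        (integrable_log_sumExp_dotProduct a))
      ((measurePreserving_comp_gaussPi Sum.inr_injective).integrable_comp_of_integrable
        (integrable_log_sumExp_dotProduct b))).trans ?_
    exact congrArg₂ (· + ·) (integral_comp_gaussPi Sum.inl_injective ha)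
      (integral_comp_gaussPi Sum.inr_injective hb)
  have hAA : ∀ p q, A p ⬝ᵥ A q = β ^ 2 *
      (((fun i => (p.1 i : ℝ)) ⬝ᵥ (fun i => (q.1 i : ℝ)) +
        (fun i => (p.2 i : ℝ)) ⬝ᵥ (fun i => (q.2 i : ℝ))) ^ 2 / ((m + n : ℕ) : ℝ)) := fun p q => by
    simp only [A, skCoeff_dotProduct_skCoeff, append_dotProduct_append]
  have hBB : ∀ p q, B p ⬝ᵥ B q = β ^ 2 *
      (((fun i => (p.1 i : ℝ)) ⬝ᵥ (fun i => (q.1 i : ℝ))) ^ 2 / m +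
        ((fun i => (p.2 i : ℝ)) ⬝ᵥ (fun i => (q.2 i : ℝ))) ^ 2 / n) := fun p q => by
    simp only [B, a, b, sumElim_dotProduct_sumElim, skCoeff_dotProduct_skCoeff, mul_add]
  rw [← hA, ← hB]
  refine integral_log_sumExp_mono A B (fun p => ?_) fun p q => ?_
  · have hsq : ∀ x : ℝ, x ^ 2 / x = x := fun x => by
      rw [sq, mul_self_div_self]
    rw [hAA, hBB, spin_dotProduct_self, spin_dotProduct_self, ← Nat.cast_add, hsq, hsq, hsq,
      Nat.cast_add]
  · rw [hAA, hBB]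
    refine mul_le_mul_of_nonneg_left (sq_add_div_le m n ?_ ?_) (sq_nonneg β) <;>
    · rintro rfl
      simp [dotProduct]

end SK

/-- For every `β ≥ 0`, the sequence of free energies `(F_N(β))_{N ≥ 1}` of the
Sherrington–Kirkpatrick model converges as `N → ∞`. -/
theorem sk_free_energy_converges (β : ℝ) (hβ : 0 ≤ β) :
    ∃ L : ℝ, Tendsto (fun N => FSK N β) atTop (nhds L) := by
  have hsub : Subadditive fun N => -skLogPartition N β := fun m n => by
    linarith [skLogPartition_add_le m n β]
  have hbdd : BddBelow (Set.range fun N : ℕ => -skLogPartition N β / N) := by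
    refine ⟨-(log (Fintype.card ({-1, 1} : Finset ℝ)) + β ^ 2 / 2), ?_⟩
    rintro _ ⟨N, rfl⟩
    simp only [neg_div, neg_le_neg_iff]
    refine div_le_of_le_mul₀ (Nat.cast_nonneg N) ?_ ?_
    · have : 0 ≤ log (Fintype.card ({-1, 1} : Finset ℝ)) := log_natCast_nonneg _
      positivity
    · rw [mul_comm]
      exact skLogPartition_le N β
  refine ⟨-hsub.lim, (hsub.tendsto_lim hbdd).neg.congr fun N => ?_⟩
  rw [FSK_eq, neg_div, neg_neg]
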